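/- In the optimal solution of the weighted sum rate problem for the MAC with simultaneous decoding, by the end of transmission at least one of the following holds: both transmitters consume all their harvested energy, or the receiver consumes all its harvested energy. Precisely, let μ > 0 and let (p₁,p₂) be a feasible power policy maximizing ∑_{i=1}^N g(p_{1i}) + μ·∑_{i=1}^N g(p_{1i}+p_{2i}) over all feasible policies. Then either (∑_{i=1}^N p_{1i} = ∑_{i=1}^N E_{1i} and ∑_{i=1}^N p_{2i} = ∑_{i=1}^N E_{2i}), or ∑_{i=1}^N (p_{1i}+p_{2i}) = ∑_{i=1}^N Ē_i. -/

import Mathlib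

open Finset

/-- The rate function `g(p) = (1/2)·log₂(1+p)`. -/
noncomputable def gfun (p : ℝ) : ℝ := Real.logb 2 (1 + p) / 2

/-- Feasibility of a power policy `(p1, p2)` for the two-user MAC with simultaneous
decoding: energy causality at both transmitters and decoding causality at the receiver
(with `φ(r) = 2^{2r} − 1`, decoding the sum rate `g(p1+p2)` costs power `p1+p2`). -/
def MACFeasible (N : ℕ) (E1 E2 Ebar : ℕ → ℝ) (p1 p2 : ℕ → ℝ) : Prop :=
  (∀ i ∈ Finset.Icc 1 N, 0 ≤ p1 i) ∧
  (∀ i ∈ Finset.Icc 1 N, 0 ≤ p2 i) ∧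
  (∀ k ∈ Finset.Icc 1 N,
      ∑ i ∈ Finset.Icc 1 k, p1 i ≤ ∑ i ∈ Finset.Icc 1 k, E1 i) ∧
  (∀ k ∈ Finset.Icc 1 N,
      ∑ i ∈ Finset.Icc 1 k, p2 i ≤ ∑ i ∈ Finset.Icc 1 k, E2 i) ∧
  (∀ k ∈ Finset.Icc 1 N,
      ∑ i ∈ Finset.Icc 1 k, (p1 i + p2 i) ≤ ∑ i ∈ Finset.Icc 1 k, Ebar i)

theorem gfun_mono_aux {a b : ℝ} (ha : 0 ≤ a) (hab : a ≤ b) : gfun a ≤ gfun b := by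
  unfold gfun
  have := Real.logb_le_logb_of_le (b := 2) (by norm_num) (by linarith : 0 < 1 + a)
    (by linarith : 1 + a ≤ 1 + b)
  linarith

theorem gfun_strict_aux {a b : ℝ} (ha : 0 ≤ a) (hab : a < b) : gfun a < gfun b := by
  unfold gfun
  have := Real.logb_lt_logb (b := 2) (by norm_num) (by linarith : 0 < 1 + a)
    (by linarith : 1 + a < 1 + b)
  linarith

theorem sum_bump_aux (N k : ℕ) (hN : 1 ≤ N) (hk : k ≤ N) (p : ℕ → ℝ) (d : ℝ) :
    ∑ i ∈ Finset.Icc 1 k, (p i + if i = N then d else 0) =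
      ∑ i ∈ Finset.Icc 1 k, p i + if k = N then d else 0 := by
  rw [Finset.sum_add_distrib, Finset.sum_ite_eq']
  congr 1
  have : N ∈ Finset.Icc 1 k ↔ k = N := by
    rw [Finset.mem_Icc]; omega
  simp only [this]

theorem bump_aux
    (N : ℕ) (hN : 1 ≤ N)
    (E1 E2 Ebar : ℕ → ℝ)
    (μ : ℝ) (hμ : 0 < μ)
    (p1 p2 : ℕ → ℝ)
    (hfeas : MACFeasible N E1 E2 Ebar p1 p2)
    (hopt : ∀ p1' p2' : ℕ → ℝ, MACFeasible N E1 E2 Ebar p1' p2' →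
        ∑ i ∈ Finset.Icc 1 N, gfun (p1' i) +
          μ * ∑ i ∈ Finset.Icc 1 N, gfun (p1' i + p2' i) ≤
        ∑ i ∈ Finset.Icc 1 N, gfun (p1 i) +
          μ * ∑ i ∈ Finset.Icc 1 N, gfun (p1 i + p2 i))
    (d1 d2 : ℝ) (h1 : 0 ≤ d1) (h2 : 0 ≤ d2) (h12 : 0 < d1 + d2)
    (s1 : ∑ i ∈ Finset.Icc 1 N, p1 i + d1 ≤ ∑ i ∈ Finset.Icc 1 N, E1 i)
    (s2 : ∑ i ∈ Finset.Icc 1 N, p2 i + d2 ≤ ∑ i ∈ Finset.Icc 1 N, E2 i)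
    (s3 : ∑ i ∈ Finset.Icc 1 N, (p1 i + p2 i) + (d1 + d2) ≤ ∑ i ∈ Finset.Icc 1 N, Ebar i) :
    False := by
  obtain ⟨f1, f2, f3, f4, f5⟩ := hfeas
  have e : ∀ i, (p1 i + if i = N then d1 else 0) + (p2 i + if i = N then d2 else 0)
      = (p1 i + p2 i) + if i = N then d1 + d2 else 0 := by
    intro i
    split_ifs <;> ring
  have key := hopt (fun i => p1 i + if i = N then d1 else 0)
    (fun i => p2 i + if i = N then d2 else 0) (by
      refine ⟨?_, ?_, ?_, ?_, ?_⟩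
      · intro i hi
        have := f1 i hi
        dsimp only
        split_ifs <;> linarith
      · intro i hi
        have := f2 i hi
        dsimp only
        split_ifs <;> linarith
      · intro k hk
        rw [sum_bump_aux N k hN (Finset.mem_Icc.1 hk).2]
        split_ifs with h
        · rw [h]; exact s1
        · linarith [f3 k hk]
      · intro k hk
        rw [sum_bump_aux N k hN (Finset.mem_Icc.1 hk).2]
        split_ifs with h
        · rw [h]; exact s2
        · linarith [f4 k hk]
      · intro k hk
        simp only [e]
        rw [sum_bump_aux N k hN (Finset.mem_Icc.1 hk).2 (fun i => p1 i + p2 i)]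
        split_ifs with h
        · rw [h]; exact s3
        · linarith [f5 k hk])
  simp only [e] at key
  have k1 : ∑ i ∈ Finset.Icc 1 N, gfun (p1 i) ≤
      ∑ i ∈ Finset.Icc 1 N, gfun (p1 i + if i = N then d1 else 0) := by
    apply Finset.sum_le_sum
    intro i hi
    apply gfun_mono_aux (f1 i hi)
    split_ifs <;> linarith
  have k2 : ∑ i ∈ Finset.Icc 1 N, gfun (p1 i + p2 i) <
      ∑ i ∈ Finset.Icc 1 N, gfun (p1 i + p2 i + if i = N then d1 + d2 else 0) := by
    apply Finset.sum_lt_sum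
    · intro i hi
      apply gfun_mono_aux (add_nonneg (f1 i hi) (f2 i hi))
      split_ifs <;> linarith
    · have hm : N ∈ Finset.Icc 1 N := Finset.mem_Icc.2 ⟨hN, le_rfl⟩
      refine ⟨N, hm, ?_⟩
      apply gfun_strict_aux (add_nonneg (f1 N hm) (f2 N hm))
      rw [if_pos rfl]
      linarith
  have k3 := mul_lt_mul_of_pos_left k2 hμ
  linarith

/-- in an optimal solution of the weighted sum rate problem for the MAC
with simultaneous decoding, by the deadline either both transmitters use all of their
energy in transmission or the receiver uses all of its energy in decoding. -/
theorem mac_weighted_sum_rate_energy_exhausted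
    (N : ℕ) (hN : 1 ≤ N)
    (E1 E2 Ebar : ℕ → ℝ)
    (hE1 : ∀ i ∈ Finset.Icc 1 N, 0 ≤ E1 i)
    (hE2 : ∀ i ∈ Finset.Icc 1 N, 0 ≤ E2 i)
    (hEbar : ∀ i ∈ Finset.Icc 1 N, 0 ≤ Ebar i)
    (μ : ℝ) (hμ : 0 < μ)
    (p1 p2 : ℕ → ℝ)
    (hfeas : MACFeasible N E1 E2 Ebar p1 p2)
    (hopt : ∀ p1' p2' : ℕ → ℝ, MACFeasible N E1 E2 Ebar p1' p2' →
        ∑ i ∈ Finset.Icc 1 N, gfun (p1' i) +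
          μ * ∑ i ∈ Finset.Icc 1 N, gfun (p1' i + p2' i) ≤
        ∑ i ∈ Finset.Icc 1 N, gfun (p1 i) +
          μ * ∑ i ∈ Finset.Icc 1 N, gfun (p1 i + p2 i)) :
    ((∑ i ∈ Finset.Icc 1 N, p1 i = ∑ i ∈ Finset.Icc 1 N, E1 i) ∧
     (∑ i ∈ Finset.Icc 1 N, p2 i = ∑ i ∈ Finset.Icc 1 N, E2 i)) ∨
    (∑ i ∈ Finset.Icc 1 N, (p1 i + p2 i) = ∑ i ∈ Finset.Icc 1 N, Ebar i) := by
  have hm : N ∈ Finset.Icc 1 N := Finset.mem_Icc.2 ⟨hN, le_rfl⟩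
  have t1 := hfeas.2.2.1 N hm
  have t2 := hfeas.2.2.2.1 N hm
  have t3 := hfeas.2.2.2.2 N hm
  by_contra hcon
  rw [not_or] at hcon
  obtain ⟨hA, hB⟩ := hcon
  have u3 := lt_of_le_of_ne t3 hB
  by_cases hc : ∑ i ∈ Finset.Icc 1 N, p1 i = ∑ i ∈ Finset.Icc 1 N, E1 i
  · have u2 := lt_of_le_of_ne t2 (fun h => hA ⟨hc, h⟩)
    obtain ⟨d, hd0, hd⟩ := exists_between (lt_min (sub_pos.2 u2) (sub_pos.2 u3))
    rw [lt_min_iff] at hd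
    exact bump_aux N hN E1 E2 Ebar μ hμ p1 p2 hfeas hopt 0 d le_rfl hd0.le (by linarith)
      (by linarith) (by linarith [hd.1]) (by linarith [hd.2])
  · have u1 := lt_of_le_of_ne t1 hc
    obtain ⟨d, hd0, hd⟩ := exists_between (lt_min (sub_pos.2 u1) (sub_pos.2 u3))
    rw [lt_min_iff] at hd
    exact bump_aux N hN E1 E2 Ebar μ hμ p1 p2 hfeas hopt d 0 hd0.le le_rfl (by linarith)
      (by linarith [hd.1]) (by linarith) (by linarith [hd.2])
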